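/- The global score function GlScore_λ has sensitivity at most 1, and its range is [0, R], where R = (λ_Int + λ_Suf)·(1/|C|) Σ_{c∈C} |D_c| + λ_Div·R_Div, with R_Div = (1/binom(|C|,2)) Σ_{i=1}^{|C|} (|C| − i)·|D_{c_i}| for an ordering with |D_{c_1}| ≤ … ≤ |D_{c_{|C|}}|. Precisely: (a) for every clustering function f with |C| ≥ 2, every attribute combination AC, dataset D and tuple t, writing D' = D + {t}, |GlScore_λ(D', f, AC) − GlScore_λ(D, f, AC)| ≤ 1; and (b) 0 ≤ GlScore_λ(D, f, AC) ≤ R. -/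

import Mathlib

noncomputable section

/-- The cluster of label `c`: the sub-multiset of tuples of `D` mapped to `c` by `f`. -/
def cl {T C : Type*} [DecidableEq C] (D : Multiset T) (f : T → C) (c : C) : Multiset T :=
  D.filter (fun t => f t = c)

/-- Low-sensitivity interestingness. -/
def Intp {T V C : Type*} [Fintype V] [DecidableEq V] [DecidableEq C]
    (D : Multiset T) (f : T → C) (c : C) (A : T → V) : ℝ :=
  (1 / 2) * ∑ a : V,
    |(((cl D f c).map A).count a : ℝ) -
      ((Multiset.card (cl D f c) : ℝ) / (Multiset.card D : ℝ)) * ((D.map A).count a : ℝ)|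

/-- Low-sensitivity sufficiency. -/
def Sufp {T V C : Type*} [Fintype V] [DecidableEq V] [DecidableEq C]
    (D : Multiset T) (f : T → C) (c : C) (A : T → V) : ℝ :=
  ∑ a : V,
    if 0 < ((cl D f c).map A).count a then
      ((((cl D f c).map A).count a : ℝ)) ^ 2 / (((D.map A).count a : ℝ))
    else 0

/-- Pairwise diversity. -/
def pdiv {T V C : Type*} [Fintype V] [DecidableEq V] [DecidableEq C]
    (D : Multiset T) (f : T → C) (c c' : C) (Ac Ac' : T → V) : ℝ :=
  (min (Multiset.card (cl D f c)) (Multiset.card (cl D f c')) : ℝ) *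
    @ite ℝ (Ac = Ac') (Classical.propDecidable _)
      ((1 / 2) * ∑ a : V,
        |(((cl D f c).map Ac).count a : ℝ) / (max (Multiset.card (cl D f c)) 1 : ℝ) -
          (((cl D f c').map Ac).count a : ℝ) / (max (Multiset.card (cl D f c')) 1 : ℝ)|)
      1

/-- Global diversity (the sum over unordered pairs of distinct labels is written as
half the sum over ordered pairs of distinct labels, legitimate since `d` is
symmetric). -/
def Divp {T V C : Type*} [Fintype V] [DecidableEq V] [Fintype C] [DecidableEq C]
    (D : Multiset T) (f : T → C) (AC : C → (T → V)) : ℝ :=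
  (1 / ((Fintype.card C).choose 2 : ℝ)) *
    ((1 / 2) * ∑ p ∈ (Finset.univ : Finset C).offDiag, pdiv D f p.1 p.2 (AC p.1) (AC p.2))

/-- `R_Div` for an ordering `e` of the labels with nondecreasing cluster sizes. -/
def RDiv {T C : Type*} [Fintype C] [DecidableEq C]
    (D : Multiset T) (f : T → C) (e : Fin (Fintype.card C) ≃ C) : ℝ :=
  (1 / ((Fintype.card C).choose 2 : ℝ)) *
    ∑ i : Fin (Fintype.card C),
      ((Fintype.card C - (i.val + 1) : ℕ) : ℝ) * (Multiset.card (cl D f (e i)) : ℝ)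

/-- The global score `GlScore_λ`. -/
def GlScore {T V C : Type*} [Fintype V] [DecidableEq V] [Fintype C] [DecidableEq C]
    (wInt wSuf wDiv : ℝ) (D : Multiset T) (f : T → C) (AC : C → (T → V)) : ℝ :=
  wInt * ((1 / (Fintype.card C : ℝ)) * ∑ c : C, Intp D f c (AC c)) +
  wSuf * ((1 / (Fintype.card C : ℝ)) * ∑ c : C, Sufp D f c (AC c)) +
  wDiv * Divp D f AC

lemma half_diff {V : Type*} [Fintype V] (p q g : V → ℝ) (h : ∀ a, |p a - q a| ≤ g a)
    (hs : ∑ a, g a ≤ 2) :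
    |(1 / 2) * (∑ a, |p a|) - (1 / 2) * (∑ a, |q a|)| ≤ 1 := by
  have h1 : |(∑ a, |p a|) - (∑ a, |q a|)| ≤ ∑ a, g a := by
    rw [← Finset.sum_sub_distrib]
    refine (Finset.abs_sum_le_sum_abs _ _).trans (Finset.sum_le_sum fun a _ => ?_)
    exact (abs_abs_sub_abs_le_abs_sub _ _).trans (h a)
  rw [← mul_sub, abs_mul, abs_of_pos (by norm_num : (0 : ℝ) < 1 / 2)]
  linarith

/-- indicator -/
def dl {V : Type*} [DecidableEq V] (b a : V) : ℝ := if a = b then 1 else 0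

lemma dl_nonneg {V : Type*} [DecidableEq V] (b a : V) : 0 ≤ dl b a := by
  unfold dl; split_ifs <;> norm_num

lemma dl_sum {V : Type*} [Fintype V] [DecidableEq V] (b : V) : ∑ a, dl b a = 1 := by
  simp [dl]

lemma count_sum {T V : Type*} [Fintype V] [DecidableEq V] (D : Multiset T) (A : T → V) :
    ∑ a, ((D.map A).count a : ℝ) = Multiset.card D := by
  have h := Multiset.sum_count_eq_card (s := Finset.univ) (m := D.map A) (by simp)
  rw [Multiset.card_map] at h
  exact_mod_cast h

lemma count_cons' {T V : Type*} [DecidableEq V] (t : T) (D : Multiset T) (A : T → V) (a : V) :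
    (((t ::ₘ D).map A).count a : ℝ) = (D.map A).count a + dl (A t) a := by
  rw [Multiset.map_cons, Multiset.count_cons]
  unfold dl
  push_cast
  rfl

lemma cl_pos {T C : Type*} [DecidableEq C] (t : T) (D : Multiset T) (f : T → C) (c : C)
    (h : f t = c) : cl (t ::ₘ D) f c = t ::ₘ cl D f c := by
  unfold cl; exact Multiset.filter_cons_of_pos _ h

lemma cl_neg {T C : Type*} [DecidableEq C] (t : T) (D : Multiset T) (f : T → C) (c : C)
    (h : f t ≠ c) : cl (t ::ₘ D) f c = cl D f c := by
  unfold cl; exact Multiset.filter_cons_of_neg _ h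

lemma cl_card_le {T C : Type*} [DecidableEq C] (D : Multiset T) (f : T → C) (c : C) :
    (Multiset.card (cl D f c) : ℝ) ≤ Multiset.card D := by
  exact_mod_cast Multiset.card_le_card (Multiset.filter_le _ _)

lemma cl_count_le {T V C : Type*} [DecidableEq V] [DecidableEq C] (D : Multiset T) (f : T → C)
    (c : C) (A : T → V) (a : V) :
    (((cl D f c).map A).count a : ℝ) ≤ (D.map A).count a := by
  exact_mod_cast Multiset.count_le_of_le _ (Multiset.map_le_map (Multiset.filter_le _ _))

lemma Intp_sens {T V C : Type*} [Fintype V] [DecidableEq V] [DecidableEq C]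
    (D : Multiset T) (f : T → C) (c : C) (A : T → V) (t : T) :
    |Intp (t ::ₘ D) f c A - Intp D f c A| ≤ 1 := by
  unfold Intp
  have hmn := cl_card_le D f c
  have hm : (0 : ℝ) ≤ Multiset.card (cl D f c) := Nat.cast_nonneg _
  have hy : ∀ a, (0 : ℝ) ≤ ((D.map A).count a : ℝ) := fun a => Nat.cast_nonneg _
  have hsy := count_sum D A
  have hd := dl_nonneg (A t)
  have hsd := dl_sum (A t)
  have hx := fun a => cl_count_le D f c A a
  have hx0 : ∀ a, (0 : ℝ) ≤ (((cl D f c).map A).count a : ℝ) := fun a => Nat.cast_nonneg _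
  by_cases h : f t = c
  · simp only [cl_pos t D f c h, count_cons', Multiset.card_cons, Nat.cast_add, Nat.cast_one]
    generalize (Multiset.card (cl D f c) : ℝ) = m at *
    generalize (Multiset.card D : ℝ) = n at *
    have hn1 : 0 < n + 1 := by linarith
    have hk : 0 ≤ (m + 1) / (n + 1) - m / n := by
      rcases eq_or_lt_of_le (hm.trans hmn) with h0 | h0
      · rw [← h0]; simp; linarith
      · rw [sub_nonneg, div_le_div_iff₀ h0 hn1]; nlinarith
    have hk1 : (m + 1) / (n + 1) ≤ 1 := by rw [div_le_one hn1]; linarith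
    apply half_diff _ _ (fun a => (1 - (m + 1) / (n + 1)) * dl (A t) a +
      ((m + 1) / (n + 1) - m / n) * ((D.map A).count a : ℝ))
    · intro a
      have h1 := mul_nonneg (sub_nonneg.2 hk1) (hd a)
      have h2 := mul_nonneg hk (hy a)
      rw [abs_le]; constructor <;> nlinarith
    · rw [Finset.sum_add_distrib, ← Finset.mul_sum, ← Finset.mul_sum, hsy, hsd]
      have h3 : m / n * n = m := by
        rcases eq_or_lt_of_le (hm.trans hmn) with h0 | h0
        · rw [← h0]; simp; linarith
        · field_simp
      have h4 : (m + 1) / (n + 1) * (n + 1) = m + 1 := by field_simp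
      have h5 : 0 ≤ (m + 1) / (n + 1) := by positivity
      nlinarith
  · simp only [cl_neg t D f c h, count_cons', Multiset.card_cons, Nat.cast_add, Nat.cast_one]
    generalize (Multiset.card (cl D f c) : ℝ) = m at *
    generalize (Multiset.card D : ℝ) = n at *
    have hn1 : 0 < n + 1 := by linarith
    have hk : 0 ≤ m / n - m / (n + 1) := by
      rcases eq_or_lt_of_le (hm.trans hmn) with h0 | h0
      · have : m = 0 := by linarith
        simp [this]
      · rw [sub_nonneg, div_le_div_iff₀ hn1 h0]; nlinarith
    have hk1 : 0 ≤ m / (n + 1) := by positivity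
    apply half_diff _ _ (fun a => (m / (n + 1)) * dl (A t) a +
      (m / n - m / (n + 1)) * ((D.map A).count a : ℝ))
    · intro a
      have h1 := mul_nonneg hk1 (hd a)
      have h2 := mul_nonneg hk (hy a)
      rw [abs_le]; constructor <;> nlinarith
    · rw [Finset.sum_add_distrib, ← Finset.mul_sum, ← Finset.mul_sum, hsy, hsd]
      have h3 : m / n * n = m := by
        rcases eq_or_lt_of_le (hm.trans hmn) with h0 | h0
        · rw [← h0]; simp; linarith
        · field_simp
      have h4 : m / (n + 1) * (n + 1) = m := by field_simp
      have h5 : m / (n + 1) ≤ 1 := by rw [div_le_one hn1]; linarith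
      nlinarith

lemma Intp_range {T V C : Type*} [Fintype V] [DecidableEq V] [DecidableEq C]
    (D : Multiset T) (f : T → C) (c : C) (A : T → V) :
    0 ≤ Intp D f c A ∧ Intp D f c A ≤ Multiset.card (cl D f c) := by
  unfold Intp
  have hmn := cl_card_le D f c
  have hm : (0 : ℝ) ≤ Multiset.card (cl D f c) := Nat.cast_nonneg _
  have hn : (0 : ℝ) ≤ Multiset.card D := Nat.cast_nonneg _
  constructor
  · positivity
  have h3 : (Multiset.card (cl D f c) : ℝ) / Multiset.card D * Multiset.card D
      = Multiset.card (cl D f c) := by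
    rcases eq_or_lt_of_le hn with h0 | h0
    · rw [← h0]; simp; linarith
    · field_simp
  have : ∑ a : V,
    |(((cl D f c).map A).count a : ℝ) -
      ((Multiset.card (cl D f c) : ℝ) / (Multiset.card D : ℝ)) * ((D.map A).count a : ℝ)|
      ≤ ∑ a : V, ((((cl D f c).map A).count a : ℝ) +
      ((Multiset.card (cl D f c) : ℝ) / (Multiset.card D : ℝ)) * ((D.map A).count a : ℝ)) := by
    refine Finset.sum_le_sum fun a _ => ?_
    have h1 : (0 : ℝ) ≤ (((cl D f c).map A).count a : ℝ) := Nat.cast_nonneg _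
    have h2 : (0 : ℝ) ≤ ((Multiset.card (cl D f c) : ℝ) / (Multiset.card D : ℝ)) *
      ((D.map A).count a : ℝ) := by positivity
    rw [abs_le]; constructor <;> linarith
  rw [Finset.sum_add_distrib, ← Finset.mul_sum, count_sum, count_sum, h3] at this
  linarith

lemma Sufp_eq {T V C : Type*} [Fintype V] [DecidableEq V] [DecidableEq C]
    (D : Multiset T) (f : T → C) (c : C) (A : T → V) :
    Sufp D f c A = ∑ a : V, (((cl D f c).map A).count a : ℝ) ^ 2 / ((D.map A).count a : ℝ) := by
  unfold Sufp
  refine Finset.sum_congr rfl fun a _ => ?_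
  split_ifs with h
  · rfl
  · have : ((cl D f c).map A).count a = 0 := by omega
    simp [this]

lemma Sufp_range {T V C : Type*} [Fintype V] [DecidableEq V] [DecidableEq C]
    (D : Multiset T) (f : T → C) (c : C) (A : T → V) :
    0 ≤ Sufp D f c A ∧ Sufp D f c A ≤ Multiset.card (cl D f c) := by
  rw [Sufp_eq]
  constructor
  · positivity
  rw [← count_sum (cl D f c) A]
  refine Finset.sum_le_sum fun a _ => ?_
  have h := cl_count_le D f c A a
  have h0 : (0 : ℝ) ≤ (((cl D f c).map A).count a : ℝ) := Nat.cast_nonneg _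
  apply div_le_of_le_mul₀ (Nat.cast_nonneg _) h0
  nlinarith

lemma Sufp_sens {T V C : Type*} [Fintype V] [DecidableEq V] [DecidableEq C]
    (D : Multiset T) (f : T → C) (c : C) (A : T → V) (t : T) :
    |Sufp (t ::ₘ D) f c A - Sufp D f c A| ≤ 1 := by
  rw [Sufp_eq, Sufp_eq, ← Finset.sum_sub_distrib, ← dl_sum (A t)]
  refine (Finset.abs_sum_le_sum_abs _ _).trans (Finset.sum_le_sum fun a _ => ?_)
  have hx := cl_count_le D f c A a
  have hx0 : (0 : ℝ) ≤ (((cl D f c).map A).count a : ℝ) := Nat.cast_nonneg _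
  by_cases h : f t = c
  · simp only [cl_pos t D f c h, count_cons']
    generalize (((cl D f c).map A).count a : ℝ) = x at *
    generalize ((D.map A).count a : ℝ) = y at *
    unfold dl
    split_ifs
    · rcases eq_or_lt_of_le (hx0.trans hx) with h0 | h0
      · have : x = 0 := by linarith
        rw [← h0, this]; simp
      · have e : (x + 1) ^ 2 / (y + 1) - x ^ 2 / y = ((2 * x + 1) * y - x ^ 2) / (y * (y + 1)) := by
          field_simp; ring
        rw [e, abs_of_nonneg, div_le_one (by positivity)]
        · nlinarith [sq_nonneg (y - x)]
        · apply div_nonneg _ (by positivity)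
          nlinarith
    · simp
  · simp only [cl_neg t D f c h, count_cons']
    generalize (((cl D f c).map A).count a : ℝ) = x at *
    generalize ((D.map A).count a : ℝ) = y at *
    unfold dl
    split_ifs
    · rcases eq_or_lt_of_le (hx0.trans hx) with h0 | h0
      · have : x = 0 := by linarith
        rw [← h0, this]; simp
      · have e : x ^ 2 / (y + 1) - x ^ 2 / y = - (x ^ 2 / (y * (y + 1))) := by
          field_simp; ring
        rw [e, abs_neg, abs_of_nonneg (by positivity), div_le_one (by positivity)]
        nlinarith
    · simp

lemma tv_range {V : Type*} [Fintype V] (x z : V → ℝ) (m k : ℝ) (hm : 0 ≤ m) (hk : 0 ≤ k)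
    (hx : ∀ a, 0 ≤ x a) (hz : ∀ a, 0 ≤ z a) (hsx : ∑ a, x a = m) (hsz : ∑ a, z a = k) :
    0 ≤ (1 / 2) * ∑ a, |x a / max m 1 - z a / max k 1| ∧
    (1 / 2) * ∑ a, |x a / max m 1 - z a / max k 1| ≤ 1 := by
  constructor
  · positivity
  have hM : 0 < max m 1 := by positivity
  have hK : 0 < max k 1 := by positivity
  have : ∑ a, |x a / max m 1 - z a / max k 1| ≤ ∑ a, (x a / max m 1 + z a / max k 1) := by
    refine Finset.sum_le_sum fun a _ => ?_
    have h1 : 0 ≤ x a / max m 1 := div_nonneg (hx a) hM.le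
    have h2 : 0 ≤ z a / max k 1 := div_nonneg (hz a) hK.le
    rw [abs_le]; constructor <;> linarith
  rw [Finset.sum_add_distrib, ← Finset.sum_div, ← Finset.sum_div, hsx, hsz] at this
  have h1 : m / max m 1 ≤ 1 := by rw [div_le_one hM]; exact le_max_left _ _
  have h2 : k / max k 1 ≤ 1 := by rw [div_le_one hK]; exact le_max_left _ _
  linarith

/-- The weighted total-variation term. -/
lemma tv_sens {V : Type*} [Fintype V] (x z d : V → ℝ) (m k : ℕ)
    (hx : ∀ a, 0 ≤ x a) (hz : ∀ a, 0 ≤ z a) (hd : ∀ a, 0 ≤ d a)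
    (hsx : ∑ a, x a = m) (hsz : ∑ a, z a = k) (hsd : ∑ a, d a = 1) :
    |min ((m : ℝ) + 1) k * ((1 / 2) * ∑ a, |(x a + d a) / max ((m : ℝ) + 1) 1 - z a / max (k : ℝ) 1|)
      - min (m : ℝ) k * ((1 / 2) * ∑ a, |x a / max (m : ℝ) 1 - z a / max (k : ℝ) 1|)| ≤ 1 := by
  have hm0 : (0 : ℝ) ≤ m := Nat.cast_nonneg _
  have hk0 : (0 : ℝ) ≤ k := Nat.cast_nonneg _
  have e1 : max ((m : ℝ) + 1) 1 = m + 1 := max_eq_left (by linarith)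
  have key : ∀ (s : ℝ) (u : V → ℝ), 0 ≤ s → s * ((1 / 2) * ∑ a, |u a|) = (1 / 2) * ∑ a, |s * u a| := by
    intro s u hs
    simp only [abs_mul, abs_of_nonneg hs, ← Finset.mul_sum]
    ring
  rcases Nat.eq_zero_or_pos k with h0 | hkpos
  · subst h0
    simp [min_eq_right hm0, min_eq_right (by linarith : (0 : ℝ) ≤ m + 1)]
  have hk1 : (1 : ℝ) ≤ k := by exact_mod_cast hkpos
  rw [e1, max_eq_left hk1, key _ _ (by positivity), key _ _ (by positivity)]
  have hsz' : (∑ a, z a / k : ℝ) = 1 := by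
    rw [← Finset.sum_div, hsz]; field_simp
  rcases Nat.lt_or_ge m k with h | h
  · have h' : (m : ℝ) + 1 ≤ k := by exact_mod_cast h
    rw [min_eq_left h', min_eq_left (by linarith : (m : ℝ) ≤ k)]
    apply half_diff _ _ (fun a => d a + z a / k)
    · intro a
      have h2 : 0 ≤ z a / k := div_nonneg (hz a) hk0
      have h3 : (m : ℝ) * (x a / max (m : ℝ) 1) = x a := by
        rcases Nat.eq_zero_or_pos m with hm | hm
        · subst hm
          have := Finset.single_le_sum (fun i _ => hx i) (Finset.mem_univ a)
          rw [hsx] at this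
          have h4 : x a = 0 := le_antisymm (by simpa using this) (hx a)
          simp [h4]
        · have hm1 : (1 : ℝ) ≤ m := by exact_mod_cast hm
          rw [max_eq_left hm1]; field_simp
      have h4 : ((m : ℝ) + 1) * ((x a + d a) / (m + 1)) = x a + d a := by field_simp
      rw [mul_sub, mul_sub, h3, h4]
      have := hd a
      rw [abs_le]; constructor <;> nlinarith
    · rw [Finset.sum_add_distrib, hsd, hsz']; norm_num
  · have h' : (k : ℝ) ≤ m := by exact_mod_cast h
    have hm1 : (1 : ℝ) ≤ m := by linarith
    rw [min_eq_right h', min_eq_right (by linarith : (k : ℝ) ≤ m + 1), max_eq_left hm1]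
    apply half_diff _ _ (fun a => x a * (k / m - k / (m + 1)) + d a * (k / (m + 1)))
    · intro a
      have h1 : 0 ≤ (k : ℝ) / m - k / (m + 1) := by
        rw [sub_nonneg]; gcongr; linarith
      have h2 := mul_nonneg (hx a) h1
      have h3 : 0 ≤ d a * ((k : ℝ) / (m + 1)) := mul_nonneg (hd a) (by positivity)
      have e : (k : ℝ) * ((x a + d a) / (m + 1) - z a / k) - k * (x a / m - z a / k)
        = d a * (k / (m + 1)) - x a * (k / m - k / (m + 1)) := by ring
      rw [e, abs_le]; constructor <;> linarith
    · rw [Finset.sum_add_distrib, ← Finset.sum_mul, ← Finset.sum_mul, hsd, hsx]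
      have e : (m : ℝ) * (k / m - k / (m + 1)) = k / (m + 1) := by field_simp; ring
      rw [e]
      have : (k : ℝ) / (m + 1) ≤ 1 := by rw [div_le_one (by linarith)]; linarith
      linarith

lemma pdiv_range {T V C : Type*} [Fintype V] [DecidableEq V] [DecidableEq C]
    (D : Multiset T) (f : T → C) (c c' : C) (A A' : T → V) :
    0 ≤ pdiv D f c c' A A' ∧
    pdiv D f c c' A A' ≤ min (Multiset.card (cl D f c) : ℝ) (Multiset.card (cl D f c') : ℝ) := by
  unfold pdiv
  have hmin : 0 ≤ min (Multiset.card (cl D f c) : ℝ) (Multiset.card (cl D f c') : ℝ) := by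
    positivity
  split_ifs with h
  · obtain ⟨h1, h2⟩ := tv_range (fun a => (((cl D f c).map A).count a : ℝ))
      (fun a => (((cl D f c').map A).count a : ℝ)) _ _ (Nat.cast_nonneg _) (Nat.cast_nonneg _)
      (fun a => Nat.cast_nonneg _) (fun a => Nat.cast_nonneg _) (count_sum _ _) (count_sum _ _)
    exact ⟨mul_nonneg hmin h1, mul_le_of_le_one_right hmin h2⟩
  · rw [mul_one]; exact ⟨hmin, le_rfl⟩

lemma min_sens (a b : ℝ) : |min (a + 1) b - min a b| ≤ 1 := by
  rw [abs_le]
  constructor <;> rcases min_cases (a + 1) b with h | h <;> rcases min_cases a b with h' | h' <;>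
    linarith

lemma pdiv_symm {T V C : Type*} [Fintype V] [DecidableEq V] [DecidableEq C]
    (D : Multiset T) (f : T → C) (c c' : C) (A A' : T → V) :
    pdiv D f c c' A A' = pdiv D f c' c A' A := by
  unfold pdiv
  by_cases h : A = A'
  · subst h
    simp only [if_true]
    rw [min_comm]
    congr 2
    exact Finset.sum_congr rfl fun a _ => abs_sub_comm _ _
  · rw [if_neg h, if_neg (fun h' => h h'.symm), min_comm]

lemma pdiv_sens_left {T V C : Type*} [Fintype V] [DecidableEq V] [DecidableEq C]
    (D : Multiset T) (f : T → C) (c c' : C) (A A' : T → V) (t : T) (hcc : c ≠ c') (h : f t = c) :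
    |pdiv (t ::ₘ D) f c c' A A' - pdiv D f c c' A A'| ≤ 1 := by
  have h' : f t ≠ c' := by rw [h]; exact hcc
  unfold pdiv
  simp only [cl_pos t D f c h, cl_neg t D f c' h', count_cons', Multiset.card_cons,
    Nat.cast_add, Nat.cast_one]
  split_ifs
  · exact tv_sens (fun a => (((cl D f c).map A).count a : ℝ))
      (fun a => (((cl D f c').map A).count a : ℝ)) (dl (A t)) _ _
      (fun a => Nat.cast_nonneg _) (fun a => Nat.cast_nonneg _) (dl_nonneg _)
      (count_sum _ _) (count_sum _ _) (dl_sum _)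
  · rw [mul_one, mul_one]; exact min_sens _ _

lemma pdiv_sens {T V C : Type*} [Fintype V] [DecidableEq V] [DecidableEq C]
    (D : Multiset T) (f : T → C) (c c' : C) (A A' : T → V) (t : T) (hcc : c ≠ c') :
    |pdiv (t ::ₘ D) f c c' A A' - pdiv D f c c' A A'| ≤ 1 := by
  by_cases h : f t = c
  · exact pdiv_sens_left D f c c' A A' t hcc h
  by_cases h' : f t = c'
  · rw [pdiv_symm _ f c, pdiv_symm _ f c]
    exact pdiv_sens_left D f c' c A' A t hcc.symm h'
  · unfold pdiv
    simp [cl_neg t D f c h, cl_neg t D f c' h']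

lemma avg_sens {C : Type*} [Fintype C] (hC : 2 ≤ Fintype.card C) (u v : C → ℝ)
    (h : ∀ c, |u c - v c| ≤ 1) :
    |(1 / (Fintype.card C : ℝ)) * ∑ c, u c - (1 / (Fintype.card C : ℝ)) * ∑ c, v c| ≤ 1 := by
  have hc : (0 : ℝ) < Fintype.card C := by exact_mod_cast (by omega : 0 < Fintype.card C)
  rw [← mul_sub, ← Finset.sum_sub_distrib, abs_mul, abs_of_pos (by positivity), one_div,
    inv_mul_le_iff₀ hc, mul_one]
  refine (Finset.abs_sum_le_sum_abs _ _).trans ((Finset.sum_le_sum fun c _ => h c).trans ?_)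
  simp

lemma choose_pos' {n : ℕ} (h : 2 ≤ n) : (0 : ℝ) < (n.choose 2 : ℝ) := by
  exact_mod_cast Nat.choose_pos h

lemma Divp_sens {T V C : Type*} [Fintype V] [DecidableEq V] [Fintype C] [DecidableEq C]
    (hC : 2 ≤ Fintype.card C) (D : Multiset T) (f : T → C) (AC : C → (T → V)) (t : T) :
    |Divp (t ::ₘ D) f AC - Divp D f AC| ≤ 1 := by
  unfold Divp
  have hc := choose_pos' hC
  rw [← mul_sub, ← mul_sub, ← Finset.sum_sub_distrib, abs_mul, abs_of_pos (by positivity), one_div,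
    inv_mul_le_iff₀ hc, mul_one, abs_mul, abs_of_pos (by norm_num : (0 : ℝ) < 1 / 2)]
  have h1 : |∑ p ∈ (Finset.univ : Finset C).offDiag,
      (pdiv (t ::ₘ D) f p.1 p.2 (AC p.1) (AC p.2) - pdiv D f p.1 p.2 (AC p.1) (AC p.2))|
      ≤ ∑ p ∈ (Finset.univ : Finset C).offDiag, (1 : ℝ) := by
    refine (Finset.abs_sum_le_sum_abs _ _).trans (Finset.sum_le_sum fun p hp => ?_)
    exact pdiv_sens _ _ _ _ _ _ _ (Finset.mem_offDiag.1 hp).2.2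
  rw [Finset.sum_const, Finset.offDiag_card, Finset.card_univ, nsmul_one, 
    Nat.cast_sub (Nat.le_mul_self _)] at h1
  rw [Nat.cast_choose_two]
  push_cast at h1
  linarith

lemma min_sum_le {n : ℕ} (s : Fin n → ℝ) :
    ∑ i, ∑ j, (if i ≠ j then min (s i) (s j) else 0)
      ≤ 2 * ∑ i : Fin n, ((n - (i.val + 1) : ℕ) : ℝ) * s i := by
  have h1 : ∀ i : Fin n, ((n - (i.val + 1) : ℕ) : ℝ) * s i = ∑ j, if i < j then s i else 0 := by
    intro i
    rw [← Finset.sum_filter, Finset.sum_const, nsmul_eq_mul]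
    congr 2
    rw [Finset.filter_lt_eq_Ioi, Fin.card_Ioi]
    omega
  have h2 : ∑ i : Fin n, ∑ j, (if i < j then s i else 0) =
      ∑ i : Fin n, ∑ j, (if j < i then s j else 0) := Finset.sum_comm
  simp only [h1]
  rw [two_mul]
  nth_rw 2 [h2]
  rw [← Finset.sum_add_distrib]
  refine Finset.sum_le_sum fun i _ => ?_
  rw [← Finset.sum_add_distrib]
  refine Finset.sum_le_sum fun j _ => ?_
  rcases lt_trichotomy i j with h | h | h
  · simp [h, h.ne, h.le, not_lt_of_ge]
  · simp [h]
  · simp [h, h.ne', h.le, not_lt_of_ge]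

lemma Divp_range {T V C : Type*} [Fintype V] [DecidableEq V] [Fintype C] [DecidableEq C]
    (D : Multiset T) (f : T → C) (AC : C → (T → V)) (e : Fin (Fintype.card C) ≃ C) :
    0 ≤ Divp D f AC ∧ Divp D f AC ≤ RDiv D f e := by
  unfold Divp RDiv
  constructor
  · have : 0 ≤ ∑ p ∈ (Finset.univ : Finset C).offDiag, pdiv D f p.1 p.2 (AC p.1) (AC p.2) :=
      Finset.sum_nonneg fun p _ => (pdiv_range _ _ _ _ _ _).1
    positivity
  apply mul_le_mul_of_nonneg_left _ (by positivity)
  have h1 : ∑ p ∈ (Finset.univ : Finset C).offDiag, pdiv D f p.1 p.2 (AC p.1) (AC p.2) ≤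
      ∑ p ∈ (Finset.univ : Finset C).offDiag,
        min (Multiset.card (cl D f p.1) : ℝ) (Multiset.card (cl D f p.2) : ℝ) :=
    Finset.sum_le_sum fun p _ => (pdiv_range _ _ _ _ _ _).2
  have h2 : ∑ p ∈ (Finset.univ : Finset C).offDiag,
        min (Multiset.card (cl D f p.1) : ℝ) (Multiset.card (cl D f p.2) : ℝ) =
      ∑ c : C, ∑ c' : C, if c ≠ c' then
        min (Multiset.card (cl D f c) : ℝ) (Multiset.card (cl D f c') : ℝ) else 0 := by
    have : (Finset.univ : Finset C).offDiag = Finset.univ.filter (fun p : C × C => p.1 ≠ p.2) := by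
      ext p; simp
    rw [this, Finset.sum_filter, Fintype.sum_prod_type]
  have h3 := min_sum_le (fun i => (Multiset.card (cl D f (e i)) : ℝ))
  have h4 : ∑ c : C, ∑ c' : C, (if c ≠ c' then
        min (Multiset.card (cl D f c) : ℝ) (Multiset.card (cl D f c') : ℝ) else 0) =
      ∑ i, ∑ j, (if i ≠ j then
        min (Multiset.card (cl D f (e i)) : ℝ) (Multiset.card (cl D f (e j)) : ℝ) else 0) := by
    rw [← Equiv.sum_comp e]
    refine Finset.sum_congr rfl fun i _ => ?_
    rw [← Equiv.sum_comp e]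
    refine Finset.sum_congr rfl fun j _ => ?_
    simp [e.injective.eq_iff]
  linarith

/-- The global score `GlScore_λ` has sensitivity at most `1`, and its range is
`[0, R]` where `R = (λ_Int + λ_Suf)·(1/|C|) Σ_c |D_c| + λ_Div·R_Div`. -/
theorem glscore_sensitivity_and_range {T V C : Type*} [Fintype V] [DecidableEq V]
    [Fintype C] [DecidableEq C] (hC : 2 ≤ Fintype.card C)
    (wInt wSuf wDiv : ℝ) (hInt : 0 ≤ wInt) (hSuf : 0 ≤ wSuf) (hDiv : 0 ≤ wDiv)
    (hsum : wInt + wSuf + wDiv = 1)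
    (f : T → C) (AC : C → (T → V)) :
    (∀ (D : Multiset T) (t : T),
      |GlScore wInt wSuf wDiv (t ::ₘ D) f AC - GlScore wInt wSuf wDiv D f AC| ≤ 1) ∧
    (∀ (D : Multiset T) (e : Fin (Fintype.card C) ≃ C),
      (∀ i j : Fin (Fintype.card C), i ≤ j →
        Multiset.card (cl D f (e i)) ≤ Multiset.card (cl D f (e j))) →
      (0 ≤ GlScore wInt wSuf wDiv D f AC ∧
        GlScore wInt wSuf wDiv D f AC ≤
          (wInt + wSuf) * ((1 / (Fintype.card C : ℝ)) *
            ∑ c : C, (Multiset.card (cl D f c) : ℝ)) + wDiv * RDiv D f e)) := by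
  constructor
  · intro D t
    have h1 := abs_le.1 (avg_sens hC _ _ fun c => Intp_sens D f c (AC c) t)
    have h2 := abs_le.1 (avg_sens hC _ _ fun c => Sufp_sens D f c (AC c) t)
    have h3 := abs_le.1 (Divp_sens hC D f AC t)
    unfold GlScore
    rw [abs_le]
    constructor <;> nlinarith [mul_le_mul_of_nonneg_left h1.1 hInt,
      mul_le_mul_of_nonneg_left h1.2 hInt, mul_le_mul_of_nonneg_left h2.1 hSuf,
      mul_le_mul_of_nonneg_left h2.2 hSuf, mul_le_mul_of_nonneg_left h3.1 hDiv,
      mul_le_mul_of_nonneg_left h3.2 hDiv]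
  · intro D e _
    obtain ⟨d1, d2⟩ := Divp_range D f AC e
    have hc : (0 : ℝ) ≤ 1 / (Fintype.card C : ℝ) := by positivity
    have i1 := mul_nonneg hc (Finset.sum_nonneg fun c (_ : c ∈ Finset.univ) =>
      (Intp_range D f c (AC c)).1)
    have i2 := mul_le_mul_of_nonneg_left (Finset.sum_le_sum fun c (_ : c ∈ Finset.univ) =>
      (Intp_range D f c (AC c)).2) hc
    have s1 := mul_nonneg hc (Finset.sum_nonneg fun c (_ : c ∈ Finset.univ) =>
      (Sufp_range D f c (AC c)).1)
    have s2 := mul_le_mul_of_nonneg_left (Finset.sum_le_sum fun c (_ : c ∈ Finset.univ) =>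
      (Sufp_range D f c (AC c)).2) hc
    unfold GlScore
    constructor
    · exact add_nonneg (add_nonneg (mul_nonneg hInt i1) (mul_nonneg hSuf s1)) (mul_nonneg hDiv d1)
    · rw [add_mul]
      exact add_le_add (add_le_add (mul_le_mul_of_nonneg_left i2 hInt)
        (mul_le_mul_of_nonneg_left s2 hSuf)) (mul_le_mul_of_nonneg_left d2 hDiv)
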